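/- Let (N_t)_{t∈ℝ} be a family of norms on ℝ^n that is uniformly equivalent near t (there exist D > 0 and δ > 0 with N_s(y) ≤ D·N_t(y) for all y ∈ ℝ^n and |s − t| < δ). Let A : ℝ → ℝ^{n×n} be continuous at t, let x : ℝ → ℝ^n be continuous at t with right derivative x'(t) = A(t)·x(t), and suppose the switched matrix measure ν_t(A(t)) is finite. Then the upper right Dini derivative of s ↦ N_s(x(s)) at t satisfies limsup_{h→0+} (N_{t+h}(x(t+h)) − N_t(x(t)))/h ≤ ν_t(A(t)) · N_t(x(t)). -/

import Mathlib

open Filter Topology MeasureTheory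

/-- `N` is a norm on `ℝ^n`. -/
structure IsNorm {n : ℕ} (N : (Fin n → ℝ) → ℝ) : Prop where
  nonneg : ∀ x, 0 ≤ N x
  eq_zero_iff : ∀ x, N x = 0 ↔ x = 0
  norm_smul : ∀ (c : ℝ) (x : Fin n → ℝ), N (c • x) = |c| * N x
  triangle : ∀ x y, N (x + y) ≤ N x + N y

/-- Supremum of `N'` over the unit sphere of the norm `N`. -/
noncomputable def sphereSup {n : ℕ} (N N' : (Fin n → ℝ) → ℝ) : ℝ :=
  sSup (N' '' {x | N x = 1})

/-- Switched matrix measure with respect to the family of norms `N t`: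
`ν_t(A) = limsup_{h→0+} (1/h)[ sup_{N_t(x)=1} N_{t+h}(x + hAx) − 1 ]`. -/
noncomputable def switchedMeasure {n : ℕ} (N : ℝ → (Fin n → ℝ) → ℝ) (t : ℝ)
    (A : Matrix (Fin n) (Fin n) ℝ) : EReal :=
  Filter.limsup (fun h : ℝ =>
    (((sphereSup (N t) (fun x => N (t + h) (x + h • A.mulVec x)) - 1) / h : ℝ) : EReal))
    (𝓝[>] (0:ℝ))

namespace IsNorm

variable {n : ℕ} {N : (Fin n → ℝ) → ℝ}

lemma map_zero (hN : IsNorm N) : N 0 = 0 := (hN.eq_zero_iff 0).2 rfl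

lemma map_sum_le (hN : IsNorm N) {ι : Type*} (s : Finset ι) (f : ι → Fin n → ℝ) :
    N (∑ i ∈ s, f i) ≤ ∑ i ∈ s, N (f i) :=
  Finset.le_sum_of_subadditive N hN.map_zero.le hN.triangle s f

lemma exists_le_mul_norm (hN : IsNorm N) : ∃ C, 0 ≤ C ∧ ∀ x, N x ≤ C * ‖x‖ := by
  refine ⟨∑ i, N (Pi.single i 1), Finset.sum_nonneg fun i _ => hN.nonneg _, fun x => ?_⟩
  calc N x = N (∑ i, x i • Pi.single i (1 : ℝ)) := by rw [← pi_eq_sum_univ' x]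
    _ ≤ ∑ i, N (x i • Pi.single i (1 : ℝ)) := hN.map_sum_le _ _
    _ ≤ ∑ i, N (Pi.single i 1) * ‖x‖ := by
      refine Finset.sum_le_sum fun i _ => ?_
      rw [hN.norm_smul, mul_comm]
      exact mul_le_mul_of_nonneg_left (norm_le_pi_norm x i) (hN.nonneg _)
    _ = (∑ i, N (Pi.single i 1)) * ‖x‖ := by rw [Finset.sum_mul]

lemma continuous (hN : IsNorm N) : Continuous N := by
  obtain ⟨C, -, hC⟩ := hN.exists_le_mul_norm
  refine (LipschitzWith.of_le_add_mul C.toNNReal fun x y => ?_).continuous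
  have h : N x ≤ N y + N (x - y) := by simpa using hN.triangle y (x - y)
  rw [dist_eq_norm]
  have := mul_le_mul_of_nonneg_right (Real.le_coe_toNNReal C) (norm_nonneg (x - y))
  linarith [hC (x - y)]

lemma exists_norm_le_mul (hN : IsNorm N) : ∃ c, 0 ≤ c ∧ ∀ x, ‖x‖ ≤ c * N x := by
  rcases (Metric.sphere (0 : Fin n → ℝ) 1).eq_empty_or_nonempty with he | hne
  · refine ⟨0, le_rfl, fun x => ?_⟩
    by_contra! hx
    rw [zero_mul] at hx
    have : ‖x‖⁻¹ • x ∈ Metric.sphere (0 : Fin n → ℝ) 1 := by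
      simp [_root_.norm_smul, hx.ne']
    simp [he] at this
  · obtain ⟨y, hy, hmin⟩ := (isCompact_sphere (0 : Fin n → ℝ) 1).exists_isMinOn hne
      hN.continuous.continuousOn
    have hy0 : y ≠ 0 := by
      rintro rfl
      simp at hy
    have hpos : 0 < N y := (hN.nonneg y).lt_of_ne fun h => hy0 ((hN.eq_zero_iff y).1 h.symm)
    refine ⟨(N y)⁻¹, by positivity, fun x => ?_⟩
    rcases eq_or_ne x 0 with rfl | hx
    · simp [hN.map_zero]
    have hx' : 0 < ‖x‖ := norm_pos_iff.2 hx
    have h : N y ≤ N (‖x‖⁻¹ • x) := hmin (by simp [_root_.norm_smul, hx'.ne'])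
    rw [hN.norm_smul, abs_of_pos (by positivity), inv_mul_eq_div, le_div_iff₀ hx'] at h
    rwa [inv_mul_eq_div, le_div_iff₀' hpos]

lemma exists_map_mulVec_le (hN : IsNorm N) (A : Matrix (Fin n) (Fin n) ℝ) :
    ∃ K, ∀ x, N (A.mulVec x) ≤ K * N x := by
  obtain ⟨C, hC0, hC⟩ := hN.exists_le_mul_norm
  obtain ⟨c, hc0, hc⟩ := hN.exists_norm_le_mul
  let L : (Fin n → ℝ) →L[ℝ] (Fin n → ℝ) := LinearMap.toContinuousLinearMap A.mulVecLin
  refine ⟨C * (‖L‖ * c), fun x => ?_⟩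
  calc N (A.mulVec x) ≤ C * ‖L x‖ := hC _
    _ ≤ C * (‖L‖ * (c * N x)) := by
      gcongr
      exact (L.le_opNorm x).trans (by gcongr; exact hc x)
    _ = C * (‖L‖ * c) * N x := by ring

/-- By homogeneity, a bound on the unit sphere extends to the whole space. -/
lemma map_add_smul_mulVec_le (hN : IsNorm N) {N' : (Fin n → ℝ) → ℝ} (hN' : IsNorm N') {D : ℝ}
    (hD : 0 ≤ D) (hle : ∀ y, N' y ≤ D * N y) (A : Matrix (Fin n) (Fin n) ℝ) (h : ℝ)
    (y : Fin n → ℝ) :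
    N' (y + h • A.mulVec y) ≤ N y * sphereSup N (fun z => N' (z + h • A.mulVec z)) := by
  have hbdd : BddAbove ((fun z => N' (z + h • A.mulVec z)) '' {z | N z = 1}) := by
    obtain ⟨K, hK⟩ := hN.exists_map_mulVec_le A
    refine ⟨D * (1 + |h| * K), ?_⟩
    rintro _ ⟨z, hz, rfl⟩
    refine (hle _).trans (mul_le_mul_of_nonneg_left ((hN.triangle _ _).trans ?_) hD)
    have := hK z
    rw [Set.mem_ofPred_eq] at hz
    rw [hz, mul_one] at this
    rw [hN.norm_smul, hz]
    gcongr
  rcases eq_or_ne y 0 with rfl | hy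
  · simp [hN.map_zero, hN'.map_zero]
  have hpos : 0 < N y := (hN.nonneg y).lt_of_ne fun h => hy ((hN.eq_zero_iff y).1 h.symm)
  have hmem : N ((N y)⁻¹ • y) = 1 := by
    rw [hN.norm_smul, abs_of_pos (by positivity), inv_mul_cancel₀ hpos.ne']
  have hle' := le_csSup hbdd ⟨_, hmem, rfl⟩
  have heq : (N y)⁻¹ • y + h • A.mulVec ((N y)⁻¹ • y) = (N y)⁻¹ • (y + h • A.mulVec y) := by
    rw [Matrix.mulVec_smul, smul_add, smul_comm h]
  simp only [heq] at hle'
  rw [hN'.norm_smul, abs_of_pos (by positivity), inv_mul_eq_div, div_le_iff₀' hpos] at hle'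
  exact hle'

end IsNorm

/-- the upper right Dini derivative of `s ↦ N_s(x(s))` at `t` is bounded
by `ν_t(A(t)) · N_t(x(t))`. -/
theorem dini_deriv_le_switchedMeasure_mul
    {n : ℕ} (N : ℝ → (Fin n → ℝ) → ℝ) (hN : ∀ s, IsNorm (N s)) (t : ℝ)
    -- the family of norms is uniformly equivalent near `t`
    (D δ : ℝ) (hD : 0 < D) (hδ : 0 < δ)
    (hunif : ∀ (y : Fin n → ℝ) (s : ℝ), |s - t| < δ → N s y ≤ D * N t y)
    (A : ℝ → Matrix (Fin n) (Fin n) ℝ)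
    -- `A` is continuous at `t`
    (hA : ∀ i j, ContinuousAt (fun s => A s i j) t)
    (x : ℝ → Fin n → ℝ)
    -- `x` is continuous at `t` with right derivative `x'(t) = A(t)·x(t)`
    (hx : ContinuousAt x t)
    (hx' : HasDerivWithinAt x ((A t).mulVec (x t)) (Set.Ici t) t)
    -- `ν_t(A(t))` is finite, with real value `ν`
    (ν : ℝ) (hν : switchedMeasure N t (A t) = ((ν : ℝ) : EReal)) :
    Filter.limsup (fun h : ℝ =>
        (((N (t + h) (x (t + h)) - N t (x t)) / h : ℝ) : EReal)) (𝓝[>] (0:ℝ))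
      ≤ ((ν * N t (x t) : ℝ) : EReal) := by
  set r := N t (x t) with hr
  have hr0 : 0 ≤ r := (hN t).nonneg _
  set R : ℝ → Fin n → ℝ := fun h => h⁻¹ • (x (t + h) - x t) - (A t).mulVec (x t) with hR
  have hRlim : Tendsto (fun h => D * N t (R h)) (𝓝[>] (0 : ℝ)) (𝓝 0) := by
    have hslope := (hasDerivWithinAt_iff_tendsto_slope' Set.self_notMem_Ioi).1
      (hx'.mono Set.Ioi_subset_Ici_self)
    have hshift : Tendsto (fun h : ℝ => t + h) (𝓝[>] (0 : ℝ)) (𝓝[>] t) := by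
      refine tendsto_nhdsWithin_iff.2 ⟨?_, ?_⟩
      · exact (Continuous.tendsto' (by fun_prop) 0 t (by simp)).mono_left nhdsWithin_le_nhds
      · filter_upwards [self_mem_nhdsWithin] with h hh
        simpa using hh
    have hRz : Tendsto R (𝓝[>] (0 : ℝ)) (𝓝 0) := by
      have := (hslope.comp hshift).sub_const ((A t).mulVec (x t))
      rw [sub_self] at this
      refine this.congr fun h => ?_
      simp [hR, slope_def_module]
    have := ((hN t).continuous.tendsto 0).comp hRz
    rw [(hN t).map_zero] at this
    simpa using this.const_mul D
  refine EReal.le_of_forall_lt_iff_le.1 fun z hz => ?_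
  rw [EReal.coe_lt_coe_iff] at hz
  have hε : 0 < (z - ν * r) / 2 := by linarith
  set η := (z - ν * r) / 2 / (r + 1) with hη
  have hη0 : 0 < η := by positivity
  have hrη : r * η ≤ (z - ν * r) / 2 := by
    rw [hη, mul_div_assoc', div_le_iff₀ (by positivity)]
    nlinarith
  have hlt : switchedMeasure N t (A t) < ((ν + η : ℝ) : EReal) := by
    rw [hν, EReal.coe_lt_coe_iff]
    linarith
  refine limsup_le_of_le (by isBoundedDefault) ?_
  filter_upwards [eventually_lt_of_limsup_lt hlt, hRlim.eventually_lt_const hε,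
    self_mem_nhdsWithin, mem_nhdsWithin_of_mem_nhds (Iio_mem_nhds hδ)] with h hg he hh hhδ
  rw [Set.mem_Ioi] at hh
  rw [EReal.coe_lt_coe_iff, div_lt_iff₀ hh] at hg
  rw [EReal.coe_le_coe_iff, div_le_iff₀ hh]
  have hle : ∀ y, N (t + h) y ≤ D * N t y := fun y =>
    hunif y (t + h) (by simpa [abs_of_pos hh] using hhδ)
  have hlin := (hN t).map_add_smul_mulVec_le (hN (t + h)) hD.le hle (A t) h (x t)
  have hdecomp : x (t + h) = (x t + h • (A t).mulVec (x t)) + h • R h := by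
    simp [hR, smul_sub, smul_inv_smul₀ hh.ne']
  have htri : N (t + h) (x (t + h)) ≤
      N (t + h) (x t + h • (A t).mulVec (x t)) + h * N (t + h) (R h) := by
    have := (hN (t + h)).triangle (x t + h • (A t).mulVec (x t)) (h • R h)
    rwa [← hdecomp, (hN (t + h)).norm_smul, abs_of_pos hh] at this
  rw [← hr] at hlin
  have hrem := mul_le_mul_of_nonneg_left ((hle (R h)).trans he.le) hh.le
  have hmain := mul_le_mul_of_nonneg_left hg.le hr0
  have hrη' := mul_le_mul_of_nonneg_right hrη hh.le
  linarith
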